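/- arXiv:1604.02514 — 4 statements merged into one kernel-verified Lean document; each statement's English description precedes it below -/
import Mathlib

section
/- Let E be a separable Banach space. A function f : T → E* from a measurable space (T,Σ) is weakly* scalarly measurable (i.e., t ↦ ⟨f(t), x⟩ is measurable for every x ∈ E) if and only if f is measurable with respect to the Borel σ-algebra of E* generated by the weak* topology. -/
/-- For a separable Banach space `E`, a function `f : T → E*` is weakly*
scalarly measurable iff it is measurable for the Borel σ-algebra generated by the weak*
topology on `E*` (modeled as `borel (WeakDual ℝ E)`). -/
theorem stmt2 {E : Type*} [NormedAddCommGroup E] [NormedSpace ℝ E] [CompleteSpace E]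
    [TopologicalSpace.SeparableSpace E]
    {T : Type*} [mT : MeasurableSpace T] (f : T → WeakDual ℝ E) :
    (∀ x : E, Measurable fun t => f t x) ↔
      @Measurable T (WeakDual ℝ E) mT (borel (WeakDual ℝ E)) f := by
  constructor
  · intro h
    -- evaluation along a dense sequence: a continuous injection into `ℕ → ℝ`
    let Φ : WeakDual ℝ E → (ℕ → ℝ) := fun φ n => φ (TopologicalSpace.denseSeq E n)
    have hΦc : Continuous Φ :=
      continuous_pi fun n => WeakDual.eval_continuous (TopologicalSpace.denseSeq E n)
    have hΦi : Function.Injective Φ := by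
      intro φ ψ hφψ
      have hfun : (fun x => φ x) = fun x => ψ x := by
        refine Continuous.ext_on (TopologicalSpace.denseRange_denseSeq E)
          (map_continuous φ) (map_continuous ψ) ?_
        rintro _ ⟨n, rfl⟩
        exact congrFun hφψ n
      exact DFunLike.coe_injective hfun
    have hΦf : Measurable (Φ ∘ f) :=
      measurable_pi_lambda _ fun n => h (TopologicalSpace.denseSeq E n)
    have hK : ∀ K : Set (WeakDual ℝ E), IsCompact K → MeasurableSet (f ⁻¹' K) := by
      intro K hK
      have h1 : f ⁻¹' K = (Φ ∘ f) ⁻¹' (Φ '' K) := by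
        rw [Set.preimage_comp, Set.preimage_image_eq K hΦi]
      rw [h1]
      exact hΦf (hK.image hΦc).isClosed.measurableSet
    rw [borel_eq_generateFrom_isClosed]
    refine measurable_generateFrom ?_
    intro C hC
    have hC' : IsClosed C := hC
    have hU : f ⁻¹' C = ⋃ n : ℕ, f ⁻¹'
        (WeakDual.toStrongDual ⁻¹' Metric.closedBall (0 : StrongDual ℝ E) (n : ℝ) ∩ C) := by
      ext t
      simp only [Set.mem_preimage, Set.mem_iUnion, Set.mem_inter_iff, mem_closedBall_zero_iff]
      constructor
      · intro ht
        obtain ⟨n, hn⟩ := exists_nat_ge ‖WeakDual.toStrongDual (f t)‖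
        exact ⟨n, hn, ht⟩
      · rintro ⟨n, -, ht⟩
        exact ht
    rw [hU]
    exact MeasurableSet.iUnion fun n =>
      hK _ ((WeakDual.isCompact_closedBall (0 : StrongDual ℝ E) n).inter_right hC')
  · intro h x
    letI : MeasurableSpace (WeakDual ℝ E) := borel _
    haveI : BorelSpace (WeakDual ℝ E) := ⟨rfl⟩
    exact (WeakDual.eval_continuous (𝕜 := ℝ) x).measurable.comp h
end

section
/- Let X be a compact Polish space and (T,Σ,μ) a finite measure space. For every nonnegative normal integrand φ : T × X → ℝ ∪ {+∞}, the integral functional J_φ(λ) = ∫_T ∫_X φ(t,x) λ(t,dx) dμ is sequentially lower semicontinuous on R(T,X) with respect to the weak topology of relaxed controls. -/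
open MeasureTheory Filter
open scoped ENNReal

theorem aux_capacity {S : Type*} [TopologicalSpace S] [PolishSpace S] [MeasurableSpace S]
    [BorelSpace S] (μ : Measure S) [IsFiniteMeasure μ] (f : (ℕ → ℕ) → S) (hf : Continuous f)
    (c : ℝ≥0∞) (hc : c < μ (Set.range f)) :
    ∃ K ⊆ Set.range f, IsCompact K ∧ c ≤ μ K := by
  classical
  let := TopologicalSpace.upgradeIsCompletelyMetrizable S
  have step : ∀ (k : ℕ) (s : {s : Set (ℕ → ℕ) // c < μ (f '' s)}),
      ∃ m : ℕ, c < μ (f '' (s.1 ∩ {x | x k ≤ m})) := by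
    rintro k ⟨s, hs⟩
    have hmono : Monotone fun m : ℕ => f '' (s ∩ {x | x k ≤ m}) := by
      intro a b hab
      apply Set.image_mono
      rintro x ⟨h1, h2⟩
      exact ⟨h1, le_trans h2 hab⟩
    have hU : f '' s = ⋃ m : ℕ, f '' (s ∩ {x | x k ≤ m}) := by
      rw [← Set.image_iUnion, ← Set.inter_iUnion]
      congr 1
      ext x
      simp only [Set.mem_inter_iff, Set.mem_iUnion, Set.mem_ofPred_eq]
      exact ⟨fun h => ⟨h, x k, le_rfl⟩, fun h => h.1⟩
    rw [hU, hmono.measure_iUnion] at hs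
    exact lt_iSup_iff.1 hs
  choose m hm using step
  let s : ℕ → {s : Set (ℕ → ℕ) // c < μ (f '' s)} := fun k =>
    Nat.rec ⟨Set.univ, by simpa using hc⟩ (fun k s => ⟨s.1 ∩ {x | x k ≤ m k s}, hm k s⟩) k
  let n : ℕ → ℕ := fun k => m k (s k)
  have hs : ∀ k, (s k).1 = {x | ∀ i < k, x i ≤ n i} := by
    intro k
    induction k with
    | zero => ext x; simp [s]
    | succ k ih =>
      have : (s (k+1)).1 = (s k).1 ∩ {x | x k ≤ n k} := rfl
      rw [this, ih]
      ext x
      simp only [Set.mem_inter_iff, Set.mem_ofPred_eq]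
      constructor
      · rintro ⟨h1, h2⟩ i hi
        rcases Nat.lt_succ_iff_lt_or_eq.1 hi with h | rfl
        · exact h1 i h
        · exact h2
      · intro h
        exact ⟨fun i hi => h i (by omega), h k (by omega)⟩
  let K : Set (ℕ → ℕ) := {x | ∀ i, x i ∈ Set.Iic (n i)}
  have hK : IsCompact K := isCompact_pi_infinite fun i => (Set.finite_Iic (n i)).isCompact
  refine ⟨f '' K, Set.image_subset_range _ _, hK.image hf, ?_⟩
  rw [Set.measure_eq_iInf_isOpen]
  refine le_iInf fun U => le_iInf fun hKU => le_iInf fun hU => ?_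
  suffices h : ∃ k, (s k).1 ⊆ f ⁻¹' U by
    obtain ⟨k, hk⟩ := h
    exact (s k).2.le.trans (measure_mono (Set.image_subset_iff.2 hk))
  by_contra! hcon
  have : ∀ k, ∃ x, (∀ i < k, x i ≤ n i) ∧ f x ∉ U := by
    intro k
    obtain ⟨x, hx, hx'⟩ := Set.not_subset.1 (hcon k)
    rw [hs] at hx
    exact ⟨x, hx, hx'⟩
  choose x hx hxU using this
  obtain ⟨y, hy, g, hg, hlim⟩ := hK.tendsto_subseq (x := fun k i => min (x k i) (n i))
    (fun k i => Set.mem_Iic.2 (min_le_right _ _))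
  have hlim2 : Tendsto (fun k => x (g k)) atTop (nhds y) := by
    rw [tendsto_pi_nhds] at hlim ⊢
    intro i
    refine (hlim i).congr' ?_
    filter_upwards [eventually_gt_atTop i] with k hk
    exact min_eq_left (hx _ _ (hk.trans_le hg.le_apply))
  have : f y ∉ U := by
    have hcl : IsClosed (Uᶜ) := hU.isClosed_compl
    exact hcl.mem_of_tendsto ((hf.tendsto y).comp hlim2) (Eventually.of_forall fun k => hxU _)
  exact this (hKU ⟨y, hy, rfl⟩)

theorem aux_analytic {S : Type*} [TopologicalSpace S] [PolishSpace S] [MeasurableSpace S]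
    [BorelSpace S] (μ : Measure S) [IsFiniteMeasure μ] (A : Set S) (hA : AnalyticSet A) :
    NullMeasurableSet A μ := by
  rw [AnalyticSet] at hA
  rcases hA with rfl | ⟨f, hf, rfl⟩
  · exact MeasurableSet.empty.nullMeasurableSet
  rcases eq_or_ne (μ (Set.range f)) 0 with h0 | h0
  · exact NullMeasurableSet.of_null h0
  obtain ⟨u, -, hu, hlim⟩ := exists_seq_strictMono_tendsto' (pos_iff_ne_zero.2 h0)
  choose K hKs hK hc using fun j => aux_capacity μ f hf (u j) (hu j).2
  have hm : MeasurableSet (⋃ j, K j) := MeasurableSet.iUnion fun j => (hK j).measurableSet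
  have : (⋃ j, K j) =ᵐ[μ] Set.range f := by
    refine ae_eq_of_subset_of_measure_ge (Set.iUnion_subset hKs) ?_ hm.nullMeasurableSet
      (measure_ne_top _ _)
    exact le_of_tendsto' hlim fun j => (hc j).trans (measure_mono (Set.subset_iUnion K j))
  exact hm.nullMeasurableSet.congr this

theorem aux_factor {T X : Type*} [MeasurableSpace T] [MeasurableSpace X] (C : Set (T × X))
    (hC : MeasurableSet C) : ∃ f : T → (ℕ → ℕ), Measurable f ∧ ∃ C' : Set ((ℕ → ℕ) × X),
      MeasurableSet C' ∧ C = (fun p : T × X => (f p.1, p.2)) ⁻¹' C' := by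
  classical
  rw [← generateFrom_prod] at hC
  induction C, hC using MeasurableSpace.generateFrom_induction with
  | hC s hs _ =>
    obtain ⟨a, ha, b, hb, rfl⟩ := hs
    refine ⟨fun t _ => if t ∈ a then 1 else 0, ?_,
      ((fun g : ℕ → ℕ => g 0) ⁻¹' {1}) ×ˢ b, ?_, ?_⟩
    · refine measurable_pi_lambda _ fun _ => ?_
      exact Measurable.ite ha measurable_const measurable_const
    · exact ((measurable_pi_apply 0) (measurableSet_singleton _)).prod hb
    · ext p; simp
  | empty => exact ⟨fun _ _ => 0, measurable_const, ∅, MeasurableSet.empty, by simp⟩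
  | compl s _ ih =>
    obtain ⟨f, hf, C', hC', rfl⟩ := ih
    exact ⟨f, hf, C'ᶜ, hC'.compl, rfl⟩
  | iUnion s _ ih =>
    choose f hf C' hC' hs using ih
    refine ⟨fun t k => f k.unpair.1 t k.unpair.2, ?_,
      ⋃ n, (fun p : (ℕ → ℕ) × X => ((fun j => p.1 (Nat.pair n j) : ℕ → ℕ), p.2)) ⁻¹' C' n,
      ?_, ?_⟩
    · refine measurable_pi_lambda _ fun k => ?_
      exact (measurable_pi_apply _).comp (hf _)
    · refine MeasurableSet.iUnion fun n => ?_
      refine Measurable.prodMk ?_ measurable_snd (hC' n)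
      exact measurable_pi_lambda _ fun j => (measurable_pi_apply _).comp measurable_fst
    · rw [Set.preimage_iUnion]
      refine Set.iUnion_congr fun n => ?_
      rw [hs n]
      ext p
      simp

theorem aux_proj {T X : Type*} [MeasurableSpace T] (μ : Measure T) [IsFiniteMeasure μ]
    [TopologicalSpace X] [PolishSpace X] [MeasurableSpace X] [BorelSpace X] (C : Set (T × X))
    (hC : MeasurableSet C) : NullMeasurableSet (Prod.fst '' C) μ := by
  obtain ⟨f, hf, C', hC', rfl⟩ := aux_factor C hC
  have h1 : NullMeasurableSet (Prod.fst '' C') (μ.map f) :=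
    aux_analytic _ _ (hC'.analyticSet.image_of_continuous continuous_fst)
  have h2 : Prod.fst '' ((fun p : T × X => (f p.1, p.2)) ⁻¹' C') = f ⁻¹' (Prod.fst '' C') := by
    ext t; simp
  rw [h2]
  exact h1.preimage (hf.quasiMeasurePreserving μ)

theorem aux_integral {T X : Type*} [MeasurableSpace T] [MeasurableSpace X] (μ : Measure T)
    [IsFiniteMeasure μ] (l : T → Measure X) (hl : ∀ t, IsProbabilityMeasure (l t))
    (hm : ∀ s : Set X, MeasurableSet s → Measurable fun t => l t s)
    (Φ : T → X → NNReal) (hΦ : Measurable fun p : T × X => Φ p.1 p.2) (M : NNReal)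
    (hM : ∀ t x, Φ t x ≤ M) :
    ∫⁻ t, ∫⁻ x, (Φ t x : ℝ≥0∞) ∂(l t) ∂μ = ENNReal.ofReal (∫ t, ∫ x, (Φ t x : ℝ) ∂(l t) ∂μ) := by
  let κ : ProbabilityTheory.Kernel T X := ⟨l, Measure.measurable_of_measurable_coe _ hm⟩
  have : ProbabilityTheory.IsMarkovKernel κ := ⟨hl⟩
  have hmeas : Measurable fun t => ∫⁻ x, (Φ t x : ℝ≥0∞) ∂(l t) :=
    Measurable.lintegral_kernel_prod_right (κ := κ) (f := fun t x => (Φ t x : ℝ≥0∞))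
      hΦ.coe_nnreal_ennreal
  have hin : ∀ t, Integrable (fun x => (Φ t x : ℝ)) (l t) := by
    intro t
    refine Integrable.of_bound (C := M) ?_ ?_
    · exact (hΦ.comp measurable_prodMk_left).coe_nnreal_real.aestronglyMeasurable
    · refine Eventually.of_forall fun x => ?_
      simpa using hM t x
  have heq : ∀ t, ∫⁻ x, (Φ t x : ℝ≥0∞) ∂(l t) = ENNReal.ofReal (∫ x, (Φ t x : ℝ) ∂(l t)) :=
    fun t => lintegral_coe_eq_integral _ (hin t)
  have hnn : ∀ t, 0 ≤ ∫ x, (Φ t x : ℝ) ∂(l t) := fun t => integral_nonneg fun x => by positivity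
  have hreal : ∀ t, ∫ x, (Φ t x : ℝ) ∂(l t) = (∫⁻ x, (Φ t x : ℝ≥0∞) ∂(l t)).toReal := by
    intro t
    rw [heq, ENNReal.toReal_ofReal (hnn t)]
  have hint : Integrable (fun t => ∫ x, (Φ t x : ℝ) ∂(l t)) μ := by
    refine Integrable.of_bound (C := M) ?_ ?_
    · simp_rw [hreal]
      exact hmeas.ennreal_toReal.aestronglyMeasurable
    · refine Eventually.of_forall fun t => ?_
      rw [Real.norm_of_nonneg (hnn t)]
      calc ∫ x, (Φ t x : ℝ) ∂(l t) ≤ ∫ x, (M : ℝ) ∂(l t) :=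
            integral_mono (hin t) (integrable_const _) fun x => by exact_mod_cast hM t x
        _ = M := by simp
  simp_rw [heq]
  exact (ofReal_integral_eq_lintegral_ofReal hint (Eventually.of_forall hnn)).symm

/-- For every nonnegative normal integrand `φ : T × X → [0,∞]` (jointly
measurable, lower semicontinuous in `x`), the integral functional
`J_φ(λ) = ∫_T ∫_X φ(t,x) λ(t,dx) dμ` is sequentially lower semicontinuous on `R(T,X)` for
the weak topology of relaxed controls. -/
theorem stmt7 {T : Type*} [MeasurableSpace T] (μ : Measure T) [IsFiniteMeasure μ]
    {X : Type*} [TopologicalSpace X] [PolishSpace X] [CompactSpace X]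
    [MeasurableSpace X] [BorelSpace X]
    (φ : T → X → ℝ≥0∞)
    (hφmeas : Measurable fun p : T × X => φ p.1 p.2)
    (hφlsc : ∀ t, LowerSemicontinuous fun x => φ t x)
    (lam : ℕ → T → Measure X) (lamLim : T → Measure X)
    (hlam_prob : ∀ i t, IsProbabilityMeasure (lam i t))
    (hlamLim_prob : ∀ t, IsProbabilityMeasure (lamLim t))
    (hlam_meas : ∀ i, ∀ s : Set X, MeasurableSet s → Measurable fun t => lam i t s)
    (hlamLim_meas : ∀ s : Set X, MeasurableSet s → Measurable fun t => lamLim t s)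
    (hweak : ∀ ψ : T → X → ℝ,
      Measurable (fun p : T × X => ψ p.1 p.2) → (∀ t, Continuous fun x => ψ t x) →
      (∃ ψ₀ : T → ℝ, Integrable ψ₀ μ ∧ ∀ t x, |ψ t x| ≤ ψ₀ t) →
      Tendsto (fun i => ∫ t, ∫ x, ψ t x ∂(lam i t) ∂μ) atTop
        (nhds (∫ t, ∫ x, ψ t x ∂(lamLim t) ∂μ))) :
    (∫⁻ t, ∫⁻ x, φ t x ∂(lamLim t) ∂μ) ≤
      atTop.liminf fun i => ∫⁻ t, ∫⁻ x, φ t x ∂(lam i t) ∂μ := by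
  classical
  rcases isEmpty_or_nonempty X with hX | hX
  · simp [lintegral_of_isEmpty]
  let := TopologicalSpace.upgradeIsCompletelyMetrizable X
  let ι := ℕ × ℕ × ℚ
  let r : ι → ℝ := fun i => 1 / ((i.2.1 : ℝ) + 1)
  have hr : ∀ i, 0 < r i := fun i => by positivity
  let z : ι → X := fun i => TopologicalSpace.denseSeq X i.1
  let q : ι → NNReal := fun i => Real.toNNReal (i.2.2 : ℝ)
  -- the sets of parameters on which `φ t` exceeds `q i` on a ball
  let A : ι → Set T := fun i => {t | ∀ x ∈ Metric.ball (z i) (2 * r i), (q i : ℝ≥0∞) < φ t x}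
  have hA : ∀ i, NullMeasurableSet (A i) μ := by
    intro i
    have hC : MeasurableSet {p : T × X | φ p.1 p.2 ≤ q i ∧ p.2 ∈ Metric.ball (z i) (2 * r i)} :=
      (measurableSet_le hφmeas measurable_const).inter
        (measurable_snd Metric.isOpen_ball.measurableSet)
    have := (aux_proj μ _ hC).compl
    convert this using 1
    ext t
    simp only [A, Set.mem_ofPred_eq, Set.mem_compl_iff, Set.mem_image, Prod.exists,
      exists_and_right, exists_eq_right, not_exists, not_and]
    exact forall_congr' fun x =>
      ⟨fun h h1 h2 => absurd (h h2) (not_lt.2 h1), fun h h2 => not_le.1 fun h1 => h h1 h2⟩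
  choose B hBA hBm hBae using fun i => (hA i).exists_measurable_subset_ae_eq
  let h : ι → X → NNReal := fun i x => Real.toNNReal (min 1 (2 - dist x (z i) / r i))
  have hh1 : ∀ i x, h i x ≤ 1 := fun i x => by
    rw [← Real.toNNReal_one]
    exact Real.toNNReal_le_toNNReal (min_le_left _ _)
  have hhc : ∀ i, Continuous (h i) := fun i => by fun_prop
  let ψ : ι → T → X → NNReal := fun i t x => if t ∈ B i then q i * h i x else 0
  have hψm : ∀ i, Measurable fun p : T × X => ψ i p.1 p.2 := by
    intro i
    refine Measurable.ite (measurable_fst (hBm i)) ?_ measurable_const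
    exact measurable_const.mul ((hhc i).measurable.comp measurable_snd)
  have hψc : ∀ i t, Continuous (ψ i t) := by
    intro i t
    by_cases ht : t ∈ B i
    · simp only [ψ, ht, if_true]
      exact continuous_const.mul (hhc i)
    · simp only [ψ, ht, if_false]
      exact continuous_const
  have hψq : ∀ i t x, ψ i t x ≤ q i := by
    intro i t x
    by_cases ht : t ∈ B i
    · simp only [ψ, ht, if_true]
      exact mul_le_of_le_one_right' (hh1 i x)
    · simp [ψ, ht]
  have hψφ : ∀ i t x, (ψ i t x : ℝ≥0∞) ≤ φ t x := by
    intro i t x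
    by_cases ht : t ∈ B i
    · by_cases hx : x ∈ Metric.ball (z i) (2 * r i)
      · exact (ENNReal.coe_le_coe.2 (hψq i t x)).trans (hBA i ht x hx).le
      · have : h i x = 0 := by
          refine Real.toNNReal_of_nonpos ((min_le_right _ _).trans ?_)
          rw [Metric.mem_ball, not_lt] at hx
          rw [sub_nonpos, le_div_iff₀ (hr i)]
          exact hx
        simp [ψ, this]
    · simp [ψ, ht]
  obtain ⟨e, he⟩ := exists_surjective_nat ι
  let Φ : ℕ → T → X → NNReal := fun k t x => (Finset.range k).sup fun j => ψ (e j) t x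
  have hΦm : ∀ k, Measurable fun p : T × X => Φ k p.1 p.2 := by
    intro k
    induction k with
    | zero => simp [Φ, measurable_const]
    | succ k ih =>
      have : (fun p : T × X => Φ (k+1) p.1 p.2)
          = fun p : T × X => max (ψ (e k) p.1 p.2) (Φ k p.1 p.2) := by
        funext p
        simp only [Φ, Finset.range_add_one, Finset.sup_insert]
      rw [this]
      exact (hψm _).max ih
  have hΦc : ∀ k t, Continuous (Φ k t) := by
    intro k t
    exact Continuous.finset_sup_apply fun j _ => hψc (e j) t
  have hΦb : ∀ k t x, Φ k t x ≤ (Finset.range k).sup fun j => q (e j) := fun k t x =>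
    Finset.sup_mono_fun fun j _ => hψq _ _ _
  have hΦφ : ∀ k t x, (Φ k t x : ℝ≥0∞) ≤ φ t x := by
    intro k t x
    induction k with
    | zero => simp [Φ]
    | succ k ih =>
      have : Φ (k+1) t x = max (ψ (e k) t x) (Φ k t x) := by
        simp only [Φ, Finset.range_add_one, Finset.sup_insert]
      rw [this, ENNReal.coe_max]
      exact max_le (hψφ _ _ _) ih
  have hΦmono : ∀ t x, Monotone fun k => (Φ k t x : ℝ≥0∞) := by
    intro t x a b hab
    exact ENNReal.coe_le_coe.2 (Finset.sup_mono (Finset.range_mono hab))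
  -- the approximation is exact almost everywhere
  have hsup : ∀ᵐ t ∂μ, ∀ x, φ t x ≤ ⨆ k, (Φ k t x : ℝ≥0∞) := by
    have : ∀ᵐ t ∂μ, ∀ i, t ∈ A i → t ∈ B i := by
      rw [ae_all_iff]
      intro i
      filter_upwards [(hBae i).mem_iff] with t ht using ht.2
    filter_upwards [this] with t ht x
    refine le_of_forall_lt fun c hc => ?_
    obtain ⟨q₀, -, hcq, hqφ⟩ := ENNReal.lt_iff_exists_rat_btwn.1 hc
    obtain ⟨ε, hε, hball⟩ := Metric.eventually_nhds_iff_ball.1 (hφlsc t x _ hqφ)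
    obtain ⟨m, hm⟩ := exists_nat_one_div_lt (show (0 : ℝ) < ε / 3 by positivity)
    have hm0 : (0 : ℝ) < 1 / ((m : ℝ) + 1) := by positivity
    obtain ⟨n, hn⟩ := (TopologicalSpace.denseRange_denseSeq X).exists_dist_lt x hm0
    obtain ⟨j, hj⟩ := he (n, m, q₀)
    have hrj : r (e j) = 1 / ((m : ℝ) + 1) := by rw [hj]
    have hzj : z (e j) = TopologicalSpace.denseSeq X n := by rw [hj]
    have hqj : q (e j) = Real.toNNReal (q₀ : ℝ) := by rw [hj]
    have hAj : t ∈ A (e j) := by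
      intro y hy
      rw [hqj]
      apply hball
      rw [Metric.mem_ball, hzj, hrj] at hy
      rw [Metric.mem_ball]
      have h3 := dist_triangle y (TopologicalSpace.denseSeq X n) x
      rw [dist_comm (TopologicalSpace.denseSeq X n) x] at h3
      linarith
    have hhj : h (e j) x = 1 := by
      have h4 : (1 : ℝ) ≤ 2 - dist x (z (e j)) / r (e j) := by
        have : dist x (z (e j)) / r (e j) ≤ 1 := by
          rw [div_le_one (hr _), hzj, hrj]
          exact hn.le
        linarith
      simp only [h]
      rw [min_eq_left h4, Real.toNNReal_one]
    have hψj : ψ (e j) t x = Real.toNNReal (q₀ : ℝ) := by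
      simp only [ψ, ht _ hAj, if_true]
      rw [hhj, mul_one, hqj]
    refine hcq.trans_le (le_trans ?_ (le_iSup _ (j + 1)))
    rw [← hψj]
    exact ENNReal.coe_le_coe.2
      (Finset.le_sup (f := fun j => ψ (e j) t x) (Finset.self_mem_range_succ j))
  let κ : ProbabilityTheory.Kernel T X :=
    ⟨lamLim, Measure.measurable_of_measurable_coe _ hlamLim_meas⟩
  have : ProbabilityTheory.IsMarkovKernel κ := ⟨hlamLim_prob⟩
  have hmct : ∫⁻ t, ∫⁻ x, φ t x ∂(lamLim t) ∂μ
      ≤ ⨆ k, ∫⁻ t, ∫⁻ x, (Φ k t x : ℝ≥0∞) ∂(lamLim t) ∂μ := by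
    rw [← lintegral_iSup]
    · refine lintegral_mono_ae ?_
      filter_upwards [hsup] with t ht
      rw [← lintegral_iSup]
      · exact lintegral_mono ht
      · exact fun k => ((hΦc k t).measurable).coe_nnreal_ennreal
      · exact fun a b hab x => hΦmono t x hab
    · intro k
      exact Measurable.lintegral_kernel_prod_right (κ := κ)
        (f := fun t x => (Φ k t x : ℝ≥0∞)) (hΦm k).coe_nnreal_ennreal
    · exact fun a b hab t => lintegral_mono fun x => hΦmono t x hab
  refine hmct.trans (iSup_le fun k => ?_)
  have htend := hweak (fun t x => (Φ k t x : ℝ)) (hΦm k).coe_nnreal_real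
    (fun t => NNReal.continuous_coe.comp (hΦc k t))
    ⟨fun _ => (((Finset.range k).sup fun j => q (e j) : NNReal) : ℝ), integrable_const _,
      fun t x => by
        rw [abs_of_nonneg (NNReal.coe_nonneg _)]
        exact_mod_cast hΦb k t x⟩
  have htend2 := (ENNReal.continuous_ofReal.tendsto _).comp htend
  rw [aux_integral μ lamLim hlamLim_prob hlamLim_meas (Φ k) (hΦm k) _ (hΦb k),
    ← htend2.liminf_eq]
  refine liminf_le_liminf (Eventually.of_forall fun i => ?_)
  simp only [Function.comp]
  rw [← aux_integral μ (lam i) (hlam_prob i) (hlam_meas i) (Φ k) (hΦm k) _ (hΦb k)]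
  exact lintegral_mono fun t => lintegral_mono fun x => hΦφ k t x
end

section
/- Let (T,Σ,μ) be a finite measure space, E a separable Banach space, W a weakly* closed subset of E*, X a weakly* compact subset of E*, and φ : T × X → ℝ an integrably bounded Carathéodory function. Then the relaxed variational problem of maximizing ∫_T ∫_X φ(t,x) λ(t,dx) dμ over relaxed controls λ ∈ R(T,X) subject to ∫_T ∫_X x λ(t,dx) dμ − ∫_T ω(t) dμ ∈ W has a solution, provided the feasible set is nonempty, where ω : T → X is Gelfand integrable. -/
open MeasureTheory

variable {T : Type*} [MeasurableSpace T] {E : Type*} [NormedAddCommGroup E] [NormedSpace ℝ E]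
  [MeasurableSpace (WeakDual ℝ E)]

/-- A relaxed control for the relaxed variational problem: a measurable family of Borel
probability measures on `E*` (with the weak* topology) concentrated on the consumption set
`X`, whose barycenter shifted by the aggregate endowment lies in `W` (the feasibility
constraint `∫_T ∫_X x λ(t,dx) dμ − ∫_T ω dμ ∈ W`, expressed via Gelfand integrals). -/
def RelaxedFeasible (μ : Measure T) (X W : Set (WeakDual ℝ E)) (ω : T → WeakDual ℝ E)
    (lam : T → Measure (WeakDual ℝ E)) : Prop :=
  (∀ s : Set (WeakDual ℝ E), MeasurableSet s → Measurable fun t => lam t s) ∧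
  (∀ t, IsProbabilityMeasure (lam t)) ∧
  (∀ t, lam t X = 1) ∧
  ∃ b : WeakDual ℝ E,
    (∀ y : E, b y = (∫ t, ∫ x, x y ∂(lam t) ∂μ) - ∫ t, ω t y ∂μ) ∧ b ∈ W

open MeasureTheory ProbabilityTheory Filter Topology

namespace Stmt8Aux

lemma measurable_toCM {T : Type*} [MeasurableSpace T] {Y : Type*} [TopologicalSpace Y]
    [CompactSpace Y] [TopologicalSpace.MetrizableSpace Y]
    [MeasurableSpace C(Y, ℝ)] [BorelSpace C(Y, ℝ)]
    (Φ : T → C(Y, ℝ)) (hΦ : ∀ y, Measurable fun t => Φ t y) : Measurable Φ := by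
  let _ := TopologicalSpace.metrizableSpaceMetric Y
  obtain ⟨D, hDc, hDd⟩ := TopologicalSpace.exists_countable_dense Y
  have hdist : ∀ g : C(Y, ℝ), Measurable fun t => dist (Φ t) g := by
    intro g
    refine measurable_of_Iic fun r => ?_
    by_cases hr : 0 ≤ r
    · have : (fun t => dist (Φ t) g) ⁻¹' Set.Iic r
          = ⋂ y ∈ D, {t | dist (Φ t y) (g y) ≤ r} := by
        ext t
        simp only [Set.mem_preimage, Set.mem_Iic, Set.mem_iInter]
        rw [ContinuousMap.dist_le hr]
        constructor
        · intro h y _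
          exact h y
        · intro h z
          have hcl : IsClosed {z : Y | dist (Φ t z) (g z) ≤ r} :=
            isClosed_le (by fun_prop) (by fun_prop)
          have hsub : closure D ⊆ {z : Y | dist (Φ t z) (g z) ≤ r} :=
            closure_minimal (fun y hy => h y hy) hcl
          exact hsub (hDd z)
      rw [this]
      refine MeasurableSet.biInter hDc fun y _ => ?_
      exact measurableSet_le ((hΦ y).dist measurable_const) measurable_const
    · have : (fun t => dist (Φ t) g) ⁻¹' Set.Iic r = ∅ := by
        ext t
        simp only [Set.mem_preimage, Set.mem_Iic, Set.mem_empty_iff_false, iff_false]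
        intro h
        exact hr (dist_nonneg.trans h)
      rw [this]
      exact MeasurableSet.empty
  refine measurable_of_isOpen fun U hU => ?_
  choose! ε hε hball using Metric.isOpen_iff.1 hU
  obtain ⟨I, hIc, hI⟩ := TopologicalSpace.isOpen_iUnion_countable
    (fun g : U => Metric.ball (g : C(Y, ℝ)) (ε g)) (fun g => Metric.isOpen_ball)
  have hUeq : U = ⋃ g ∈ I, Metric.ball (g : C(Y, ℝ)) (ε g) := by
    rw [hI]
    apply Set.Subset.antisymm
    · intro g hg
      exact Set.mem_iUnion.2 ⟨⟨g, hg⟩, Metric.mem_ball_self (hε g hg)⟩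
    · exact Set.iUnion_subset fun g => hball g g.2
  rw [hUeq, Set.preimage_iUnion₂]
  refine MeasurableSet.biUnion hIc fun g _ => ?_
  exact measurableSet_lt (hdist g) measurable_const

lemma integral_formula {T : Type*} [MeasurableSpace T] {S Y : Type*} [MeasurableSpace S]
    [MeasurableSpace Y] (μ : Measure T) [IsFiniteMeasure μ] (Φ : T → S) (hΦ : Measurable Φ)
    (k : S → ℝ) (hk : Measurable k) (hk0 : ∀ s, 0 ≤ k s)
    (hν : IsProbabilityMeasure (μ.withDensity fun t => ENNReal.ofReal (k (Φ t))))
    (κ : Kernel T Y) [IsMarkovKernel κ] (G : S × Y → ℝ) (hG : Measurable G)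
    (C : ℝ) (hC : ∀ p, |G p| ≤ C) :
    ∫ p, G p ∂(((μ.withDensity fun t => ENNReal.ofReal (k (Φ t))) ⊗ₘ κ).map (Prod.map Φ id))
      = ∫ t, ∫ y, k (Φ t) * G (Φ t, y) ∂(κ t) ∂μ := by
  have hm : Measurable (Prod.map Φ (id : Y → Y)) := hΦ.prodMap measurable_id
  rw [integral_map hm.aemeasurable hG.aestronglyMeasurable, Measure.integral_compProd]
  · rw [integral_withDensity_eq_integral_toReal_smul (by fun_prop) (by simp)]
    refine integral_congr_ae (ae_of_all _ fun t => ?_)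
    simp only [ENNReal.toReal_ofReal (hk0 _), integral_const_mul, smul_eq_mul]
    rfl
  · refine Integrable.of_bound (hG.comp hm).aestronglyMeasurable C (ae_of_all _ fun p => hC _)

lemma disint {T : Type*} [MeasurableSpace T] {S Y : Type*} [MeasurableSpace S]
    [MeasurableSpace Y] [StandardBorelSpace Y] [Nonempty Y] (ν : Measure T)
    [IsProbabilityMeasure ν] (Φ : T → S) (hΦ : Measurable Φ)
    (ρ : Measure (S × Y)) [IsProbabilityMeasure ρ] (hρ : ρ.fst = ν.map Φ) :
    (ν ⊗ₘ (ρ.condKernel.comap Φ hΦ)).map (Prod.map Φ id) = ρ := by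
  have hm : Measurable (Prod.map Φ (id : Y → Y)) := hΦ.prodMap measurable_id
  conv_rhs => rw [← ρ.disintegrate ρ.condKernel, hρ]
  have : IsProbabilityMeasure (ν.map Φ) := Measure.isProbabilityMeasure_map hΦ.aemeasurable
  ext s hs
  rw [Measure.map_apply hm hs, Measure.compProd_apply (hm hs), Measure.compProd_apply hs,
    lintegral_map (Kernel.measurable_kernel_prodMk_left hs) hΦ]
  rfl

lemma fst_map {T : Type*} [MeasurableSpace T] {S Y : Type*} [MeasurableSpace S]
    [MeasurableSpace Y] (ν : Measure T) [IsProbabilityMeasure ν] (Φ : T → S) (hΦ : Measurable Φ)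
    (κ : Kernel T Y) [IsMarkovKernel κ] :
    ((ν ⊗ₘ κ).map (Prod.map Φ id)).fst = ν.map Φ := by
  have hm : Measurable (Prod.map Φ (id : Y → Y)) := hΦ.prodMap measurable_id
  rw [Measure.fst, Measure.map_map measurable_fst hm]
  have : (Prod.fst ∘ Prod.map Φ (id : Y → Y)) = Φ ∘ Prod.fst := rfl
  rw [this, ← Measure.map_map hΦ measurable_fst]
  congr 1
  exact Measure.fst_compProd ν κ

lemma compact_fst {S Y : Type*} [TopologicalSpace S] [PolishSpace S]
    [MeasurableSpace S] [BorelSpace S] [TopologicalSpace Y] [CompactSpace Y] [PolishSpace Y]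
    [MeasurableSpace Y] [BorelSpace Y]
    (ν : ProbabilityMeasure S) :
    IsCompact {ρ : ProbabilityMeasure (S × Y) | ρ.map measurable_fst.aemeasurable = ν} := by
  have hcl : IsClosed {ρ : ProbabilityMeasure (S × Y) | ρ.map measurable_fst.aemeasurable = ν} :=
    isClosed_singleton.preimage (ProbabilityMeasure.continuous_map continuous_fst)
  rw [← hcl.closure_eq]
  apply isCompact_closure_of_isTightMeasureSet
  rw [isTightMeasureSet_iff_exists_isCompact_measure_compl_le]
  intro ε hε
  have h1 : IsTightMeasureSet {(ν : Measure S)} := isTightMeasureSet_singleton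
  obtain ⟨K, hK, h⟩ := (isTightMeasureSet_iff_exists_isCompact_measure_compl_le.1 h1) ε hε
  refine ⟨K ×ˢ Set.univ, hK.prod isCompact_univ, ?_⟩
  rintro _ ⟨ρ, hρ, rfl⟩
  have h2 := h _ rfl
  have hρ' : (ρ : Measure (S × Y)).map Prod.fst = (ν : Measure S) := by
    rw [← Set.mem_ofPred.1 hρ]; rfl
  rw [← hρ', Measure.map_apply measurable_fst hK.measurableSet.compl] at h2
  convert h2 using 2
  ext p; simp

lemma core {T : Type*} [MeasurableSpace T] {Y : Type*} [TopologicalSpace Y]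
    [CompactSpace Y] [TopologicalSpace.MetrizableSpace Y] [MeasurableSpace Y] [BorelSpace Y]
    [Nonempty Y] (μ : Measure T) [IsFiniteMeasure μ] (hμ : μ ≠ 0)
    (Φ : T → C(Y, ℝ)) (hΦ : ∀ y, Measurable fun t => Φ t y)
    (ψ : T → ℝ) (hψ : Integrable ψ μ) (hΦψ : ∀ t, ‖Φ t‖ ≤ ψ t)
    (P : Set (C(Y, ℝ) → ℝ)) (hP : IsClosed P)
    (κ₁ : Kernel T Y) [IsMarkovKernel κ₁] (hκ₁ : (fun h => ∫ t, ∫ y, h y ∂(κ₁ t) ∂μ) ∈ P) :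
    ∃ κ : Kernel T Y, IsMarkovKernel κ ∧ (fun h => ∫ t, ∫ y, h y ∂(κ t) ∂μ) ∈ P ∧
      ∀ κ' : Kernel T Y, IsMarkovKernel κ' → (fun h => ∫ t, ∫ y, h y ∂(κ' t) ∂μ) ∈ P →
        ∫ t, ∫ y, Φ t y ∂(κ' t) ∂μ ≤ ∫ t, ∫ y, Φ t y ∂(κ t) ∂μ := by
  let _ := TopologicalSpace.metrizableSpaceMetric Y
  let _ : MeasurableSpace C(Y, ℝ) := borel _
  have : BorelSpace C(Y, ℝ) := ⟨rfl⟩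
  have : PolishSpace Y := inferInstance
  have : PolishSpace C(Y, ℝ) := inferInstance
  have hΦm : Measurable Φ := measurable_toCM Φ hΦ
  have hint : Integrable (fun t => 1 + ‖Φ t‖) μ := by
    refine (integrable_const 1).add (hψ.mono' hΦm.norm.aestronglyMeasurable (ae_of_all _ ?_))
    intro t
    simpa using hΦψ t
  set c : ℝ := ∫ t, (1 + ‖Φ t‖) ∂μ with hc
  have hc0 : 0 < c := by
    rw [hc, integral_pos_iff_support_of_nonneg (fun t => by positivity) hint]
    have : (Function.support fun t => 1 + ‖Φ t‖) = Set.univ := by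
      ext t
      simp only [Function.mem_support, Set.mem_univ, iff_true]
      positivity
    rw [this]
    exact Measure.measure_univ_pos.2 hμ
  let k : C(Y, ℝ) → ℝ := fun g => (1 + ‖g‖) / c
  have hkc : Continuous k := by fun_prop
  have hk0 : ∀ g, 0 < k g := fun g => by positivity
  let ν : Measure T := μ.withDensity fun t => ENNReal.ofReal (k (Φ t))
  have hν : IsProbabilityMeasure ν := by
    constructor
    rw [withDensity_apply _ MeasurableSet.univ, Measure.restrict_univ,
      ← ofReal_integral_eq_lintegral_ofReal (hint.div_const c) (ae_of_all _ fun t => (hk0 _).le),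
      integral_div, ← hc, div_self hc0.ne', ENNReal.ofReal_one]
  let ν' : ProbabilityMeasure C(Y, ℝ) :=
    ⟨ν.map Φ, Measure.isProbabilityMeasure_map hΦm.aemeasurable⟩
  -- bounded continuous test functions
  let q : C(Y, ℝ) → C(Y, ℝ) × Y → ℝ := fun h p => h p.2 / k p.1
  have hq : ∀ h, Continuous (q h) := fun h =>
    (by fun_prop : Continuous fun p : C(Y, ℝ) × Y => h p.2).div (hkc.comp continuous_fst)
      fun p => (hk0 p.1).ne'
  have hqb : ∀ h p, |q h p| ≤ ‖h‖ * c := by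
    intro h p
    have h1 : |h p.2| ≤ ‖h‖ := h.norm_coe_le_norm p.2
    have h2 := norm_nonneg p.1
    have h3 := norm_nonneg h
    simp only [q, k]
    rw [div_div_eq_mul_div, abs_div, abs_mul, abs_of_pos hc0,
      abs_of_pos (show 0 < 1 + ‖p.1‖ by positivity),
      div_le_iff₀ (by positivity)]
    nlinarith [mul_le_mul_of_nonneg_right h1 hc0.le, mul_nonneg (mul_nonneg h3 hc0.le) h2]
  let o : C(Y, ℝ) × Y → ℝ := fun p => p.1 p.2 / k p.1
  have ho : Continuous o :=
    (by fun_prop : Continuous fun p : C(Y, ℝ) × Y => p.1 p.2).div (hkc.comp continuous_fst)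
      fun p => (hk0 p.1).ne'
  have hob : ∀ p, |o p| ≤ c := by
    intro p
    have h1 : |p.1 p.2| ≤ ‖p.1‖ := p.1.norm_coe_le_norm p.2
    have h2 := norm_nonneg p.1
    simp only [o, k]
    rw [div_div_eq_mul_div, abs_div, abs_mul, abs_of_pos hc0,
      abs_of_pos (show 0 < 1 + ‖p.1‖ by positivity),
      div_le_iff₀ (by positivity)]
    nlinarith [mul_le_mul_of_nonneg_right h1 hc0.le]
  have hcontint : ∀ (G : C(Y, ℝ) × Y → ℝ) (_ : Continuous G) (C : ℝ) (_ : ∀ p, |G p| ≤ C),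
      Continuous fun ρ : ProbabilityMeasure (C(Y, ℝ) × Y) =>
        ∫ p, G p ∂(ρ : Measure (C(Y, ℝ) × Y)) := by
    intro G hG C hC
    exact ProbabilityMeasure.continuous_integral_boundedContinuousFunction
      (BoundedContinuousFunction.ofNormedAddCommGroup G hG C hC)
  have hm : Measurable (Prod.map Φ (id : Y → Y)) := hΦm.prodMap measurable_id
  let R : (κ : Kernel T Y) → IsMarkovKernel κ → ProbabilityMeasure (C(Y, ℝ) × Y) := fun κ _ =>
    ⟨(ν ⊗ₘ κ).map (Prod.map Φ id), Measure.isProbabilityMeasure_map hm.aemeasurable⟩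
  have hRq : ∀ κ hκ h, ∫ p, q h p ∂(R κ hκ : Measure (C(Y, ℝ) × Y))
      = ∫ t, ∫ y, h y ∂(κ t) ∂μ := by
    intro κ hκ h
    refine (integral_formula μ Φ hΦm k hkc.measurable (fun g => (hk0 g).le) hν κ (q h)
      (hq h).measurable _ (hqb h)).trans ?_
    refine integral_congr_ae (ae_of_all _ fun t => integral_congr_ae (ae_of_all _ fun y => ?_))
    exact mul_div_cancel₀ _ (hk0 (Φ t)).ne'
  have hRo : ∀ κ hκ, ∫ p, o p ∂(R κ hκ : Measure (C(Y, ℝ) × Y))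
      = ∫ t, ∫ y, Φ t y ∂(κ t) ∂μ := by
    intro κ hκ
    refine (integral_formula μ Φ hΦm k hkc.measurable (fun g => (hk0 g).le) hν κ o
      ho.measurable _ hob).trans ?_
    refine integral_congr_ae (ae_of_all _ fun t => integral_congr_ae (ae_of_all _ fun y => ?_))
    exact mul_div_cancel₀ _ (hk0 (Φ t)).ne'
  let K : Set (ProbabilityMeasure (C(Y, ℝ) × Y)) :=
    {ρ | ρ.map measurable_fst.aemeasurable = ν'} ∩
      {ρ | (fun h => ∫ p, q h p ∂(ρ : Measure (C(Y, ℝ) × Y))) ∈ P}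
  have hK : IsCompact K := by
    refine (compact_fst ν').inter_right (hP.preimage ?_)
    exact continuous_pi fun h => hcontint _ (hq h) _ (hqb h)
  have hRK : ∀ κ hκ, (fun h => ∫ t, ∫ y, h y ∂(κ t) ∂μ) ∈ P → R κ hκ ∈ K := by
    intro κ hκ hκP
    refine ⟨?_, ?_⟩
    · apply Subtype.ext
      exact fst_map ν Φ hΦm κ
    · change (fun h => ∫ p, q h p ∂(R κ hκ : Measure (C(Y, ℝ) × Y))) ∈ P
      simp only [hRq]
      exact hκP
  obtain ⟨ρ, hρK, hρ⟩ := hK.exists_isMaxOn ⟨_, hRK κ₁ inferInstance hκ₁⟩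
    (hcontint o ho c hob).continuousOn
  have hfst : (ρ : Measure (C(Y, ℝ) × Y)).fst = ν.map Φ := congrArg Subtype.val hρK.1
  have hκ : IsMarkovKernel ((ρ : Measure (C(Y, ℝ) × Y)).condKernel.comap Φ hΦm) := inferInstance
  have hRρ : R _ hκ = ρ := by
    apply Subtype.ext
    exact disint ν Φ hΦm (ρ : Measure (C(Y, ℝ) × Y)) hfst
  refine ⟨_, hκ, ?_, ?_⟩
  · have := hρK.2
    rw [← hRρ] at this
    change (fun h => ∫ p, q h p ∂(R _ hκ : Measure (C(Y, ℝ) × Y))) ∈ P at this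
    simp only [hRq] at this
    exact this
  · intro κ' hκ' hP'
    have := hρ (hRK κ' hκ' hP')
    rw [← hRρ] at this
    change ∫ p, o p ∂(R κ' hκ' : Measure (C(Y, ℝ) × Y)) ≤
      ∫ p, o p ∂(R _ hκ : Measure (C(Y, ℝ) × Y)) at this
    rw [hRo κ' hκ', hRo _ hκ] at this
    exact this


lemma toKernel {T V : Type*} [MeasurableSpace T] [MeasurableSpace V] (X : Set V)
    (hX : MeasurableSet X) (lam : T → Measure V)
    (h1 : ∀ s, MeasurableSet s → Measurable fun t => lam t s)
    (h2 : ∀ t, IsProbabilityMeasure (lam t)) (h3 : ∀ t, lam t X = 1) :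
    ∃ κ : Kernel T X, IsMarkovKernel κ ∧
      ∀ t (F : V → ℝ), ∫ x, F x ∂(lam t) = ∫ x : X, F x ∂(κ t) := by
  have hemb := MeasurableEmbedding.subtype_coe hX
  let κ : Kernel T X :=
    { toFun := fun t => (lam t).comap Subtype.val
      measurable' := by
        refine Measure.measurable_of_measurable_coe _ fun s hs => ?_
        simp only [hemb.comap_apply]
        exact h1 _ (hemb.measurableSet_image.2 hs) }
  refine ⟨κ, ⟨fun t => ⟨?_⟩⟩, fun t F => ?_⟩
  · change (lam t).comap Subtype.val Set.univ = 1
    rw [hemb.comap_apply, Set.image_univ, Subtype.range_coe]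
    exact h3 t
  · change _ = ∫ x : X, F x ∂((lam t).comap Subtype.val)
    rw [integral_subtype_comap hX]
    have := h2 t
    rw [Measure.restrict_eq_self_of_ae_mem]
    exact (prob_compl_eq_zero_iff hX).2 (h3 t)

lemma ofKernel {T V : Type*} [MeasurableSpace T] [MeasurableSpace V] (X : Set V)
    (hX : MeasurableSet X) (κ : Kernel T X) [IsMarkovKernel κ] :
    ∃ lam : T → Measure V, (∀ s, MeasurableSet s → Measurable fun t => lam t s) ∧
      (∀ t, IsProbabilityMeasure (lam t)) ∧ (∀ t, lam t X = 1) ∧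
      ∀ t (F : V → ℝ), ∫ x, F x ∂(lam t) = ∫ x : X, F x ∂(κ t) := by
  have hemb := MeasurableEmbedding.subtype_coe hX
  refine ⟨fun t => (κ t).map Subtype.val, ?_, ?_, ?_, ?_⟩
  · intro s hs
    simp only [Measure.map_apply measurable_subtype_coe hs]
    exact κ.measurable_coe (measurable_subtype_coe hs)
  · intro t
    exact Measure.isProbabilityMeasure_map measurable_subtype_coe.aemeasurable
  · intro t
    rw [Measure.map_apply measurable_subtype_coe hX]
    simp
  · intro t F
    exact hemb.integral_map F

end Stmt8Aux

/-- `(T,Σ,μ)` finite measure space, `E` separable Banach, `W ⊆ E*` weakly*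
closed, `X ⊆ E*` weakly* compact, `φ` an integrably bounded Carathéodory function, and
`ω : T → X` Gelfand integrable. If the feasible set of the relaxed variational problem is
nonempty, then the problem of maximizing `∫_T ∫_X φ(t,x) λ(t,dx) dμ` subject to
`∫_T ∫_X x λ(t,dx) dμ − ∫_T ω dμ ∈ W` over relaxed controls has a solution. -/
theorem stmt8 (μ : Measure T) [IsFiniteMeasure μ]
    [CompleteSpace E] [TopologicalSpace.SeparableSpace E]
    [BorelSpace (WeakDual ℝ E)]
    (W : Set (WeakDual ℝ E)) (hW : IsClosed W)
    (X : Set (WeakDual ℝ E)) (hX : IsCompact X)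
    (φ : T → WeakDual ℝ E → ℝ)
    (hφmeas : Measurable fun p : T × WeakDual ℝ E => φ p.1 p.2)
    (hφcont : ∀ t, ContinuousOn (φ t) X)
    (ψ : T → ℝ) (hψ : Integrable ψ μ) (hφbd : ∀ t, ∀ x ∈ X, |φ t x| ≤ ψ t)
    (ω : T → WeakDual ℝ E) (hωX : ∀ t, ω t ∈ X)
    (hωint : ∀ y : E, Integrable (fun t => ω t y) μ)
    (hne : ∃ lam, RelaxedFeasible μ X W ω lam) :
    ∃ lam₀, RelaxedFeasible μ X W ω lam₀ ∧
      ∀ lam, RelaxedFeasible μ X W ω lam →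
        (∫ t, ∫ x, φ t x ∂(lam t) ∂μ) ≤ ∫ t, ∫ x, φ t x ∂(lam₀ t) ∂μ := by
  by_cases hμ : μ = 0
  · obtain ⟨lam, hlam⟩ := hne
    exact ⟨lam, hlam, fun _ _ => by simp [hμ]⟩
  have hTne : Nonempty T := by
    by_contra h
    rw [not_nonempty_iff] at h
    exact hμ (Measure.eq_zero_of_isEmpty μ)
  obtain ⟨t₀⟩ := hTne
  have : Nonempty X := ⟨⟨ω t₀, hωX t₀⟩⟩
  have : CompactSpace X := isCompact_iff_compactSpace.1 hX
  have : TopologicalSpace.MetrizableSpace X := WeakDual.metrizable_of_isCompact ℝ E X hX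
  have hXm : MeasurableSet X := hX.isClosed.measurableSet
  obtain ⟨C, hC0, hC⟩ : ∃ C : ℝ, 0 ≤ C ∧ ∀ x ∈ X, ∀ y : E, |x y| ≤ C * ‖y‖ := by
    have hb : Bornology.IsBounded X :=
      WeakDual.isBounded_iff_isVonNBounded.2 (hX.isVonNBounded ℝ)
    rw [← WeakDual.isBounded_toWeakDual_preimage_iff_isBounded, isBounded_iff_forall_norm_le] at hb
    obtain ⟨C, hC⟩ := hb
    refine ⟨C, (norm_nonneg _).trans (hC (WeakDual.toStrongDual (ω t₀)) (hωX t₀)), ?_⟩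
    intro x hx y
    exact (WeakDual.toStrongDual x).le_of_opNorm_le (hC (WeakDual.toStrongDual x) hx) y
  let Φ : T → C(X, ℝ) := fun t => ⟨X.restrict (φ t), (hφcont t).restrict⟩
  let ev : E → C(X, ℝ) := fun y =>
    ⟨fun x => x.1 y, (WeakDual.eval_continuous y).comp continuous_subtype_val⟩
  let B : ℝ := 2 * (C * μ.real Set.univ)
  let P : Set (C(X, ℝ) → ℝ) := (fun p (y : E) => p (ev y) - ∫ t, ω t y ∂μ) ⁻¹'
    ((fun (b : WeakDual ℝ E) (y : E) => b y) ''
      (W ∩ WeakDual.toStrongDual ⁻¹' Metric.closedBall 0 B))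
  have hP : IsClosed P := by
    refine IsClosed.preimage (continuous_pi fun y => ?_) ?_
    · exact (continuous_apply (ev y)).sub continuous_const
    · refine IsCompact.isClosed (IsCompact.image ?_ ?_)
      · exact (WeakDual.isCompact_closedBall (𝕜 := ℝ) (0 : StrongDual ℝ E) B).inter_left hW
      · exact continuous_pi fun y => WeakDual.eval_continuous y
  -- correspondence of the feasibility constraints
  have hfeas : ∀ (κ : Kernel T X) (_ : IsMarkovKernel κ),
      (∃ b : WeakDual ℝ E, (∀ y : E, b y = (∫ t, ∫ x : X, x.1 y ∂(κ t) ∂μ) - ∫ t, ω t y ∂μ)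
        ∧ b ∈ W) → (fun h : C(X, ℝ) => ∫ t, ∫ x, h x ∂(κ t) ∂μ) ∈ P := by
    rintro κ hκ ⟨b, hb, hbW⟩
    refine ⟨b, ⟨hbW, ?_⟩, funext hb⟩
    rw [Set.mem_preimage, mem_closedBall_zero_iff]
    refine ContinuousLinearMap.opNorm_le_bound _ (by positivity) fun y => ?_
    change ‖b y‖ ≤ _
    rw [hb y]
    have e1 : ‖∫ t, ∫ x : X, x.1 y ∂(κ t) ∂μ‖ ≤ C * ‖y‖ * μ.real Set.univ := by
      refine norm_integral_le_of_norm_le_const (ae_of_all _ fun t => ?_)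
      have := norm_integral_le_of_norm_le_const (μ := κ t) (f := fun x : X => x.1 y)
        (C := C * ‖y‖) (ae_of_all _ fun x => hC x.1 x.2 y)
      simpa using this
    have e2 : ‖∫ t, ω t y ∂μ‖ ≤ C * ‖y‖ * μ.real Set.univ :=
      norm_integral_le_of_norm_le_const (ae_of_all _ fun t => hC _ (hωX t) y)
    refine (norm_sub_le _ _).trans ((add_le_add e1 e2).trans (le_of_eq ?_))
    simp only [B]
    ring
  obtain ⟨lam₁, h1, h2, h3, b₁, hb₁, hb₁W⟩ := hne
  obtain ⟨κ₁, hκ₁, hint₁⟩ := Stmt8Aux.toKernel X hXm lam₁ h1 h2 h3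
  have hκ₁P := hfeas κ₁ hκ₁ ⟨b₁, fun y => by
    rw [hb₁ y]
    simp only [hint₁ _ fun x => x y], hb₁W⟩
  obtain ⟨κ, hκ, ⟨b, ⟨hbW, -⟩, hb⟩, hmax⟩ := Stmt8Aux.core μ hμ Φ
    (fun x => hφmeas.comp (measurable_id.prodMk measurable_const)) ψ hψ
    (fun t => (ContinuousMap.norm_le _ ((abs_nonneg _).trans (hφbd t _ (hωX t)))).2
      fun x => hφbd t x.1 x.2) P hP κ₁ hκ₁P
  obtain ⟨lam, hl1, hl2, hl3, hint⟩ := Stmt8Aux.ofKernel X hXm κ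
  refine ⟨lam, ⟨hl1, hl2, hl3, b, fun y => ?_, hbW⟩, ?_⟩
  · simp only [hint _ fun x => x y]
    exact congrFun hb y
  · rintro lam' ⟨g1, g2, g3, b', hb', hb'W⟩
    obtain ⟨κ', hκ', hint'⟩ := Stmt8Aux.toKernel X hXm lam' g1 g2 g3
    have hκ'P := hfeas κ' hκ' ⟨b', fun y => by
      rw [hb' y]
      simp only [hint' _ fun x => x y], hb'W⟩
    simp only [hint', hint]
    exact hmax κ' hκ' hκ'P
end

section
/- Let (T,Σ,μ) be a complete finite measure space, E a separable Banach space, and Γ : T ⇉ E* an integrably bounded, weakly* closed convex-valued multifunction with graph in Σ ⊗ Borel(E*, w*). Then the set S¹_Γ of Gelfand integrable selectors of Γ is convex and compact for the topology σ(G¹_{E*}, L^∞ ⊗ E). -/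
open MeasureTheory

variable {T : Type*} [MeasurableSpace T] {E : Type*} [NormedAddCommGroup E] [NormedSpace ℝ E]
  [MeasurableSpace (WeakDual ℝ E)]

/-- The set `S¹_Γ` of Gelfand integrable selectors of a multifunction `Γ : T ⇉ E*`
(weak* Borel measurable functions, scalarly integrable, belonging to `Γ` a.e.). -/
def gelfandSelectors (μ : Measure T) (Γ : T → Set (WeakDual ℝ E)) :
    Set (T → WeakDual ℝ E) :=
  {f | Measurable f ∧ (∀ y : E, Integrable (fun t => f t y) μ) ∧ ∀ᵐ t ∂μ, f t ∈ Γ t}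

/-- The canonical pairing of a function `f : T → E*` with elementary tensors `φ ⊗ y`,
`φ ∈ L^∞(μ)` (bounded measurable), `y ∈ E`: `⟨φ ⊗ y, f⟩ = ∫_T φ(t) ⟨f(t), y⟩ dμ`. The
topology `σ(G¹_{E*}, L^∞ ⊗ E)` on `G¹(μ,E*)` is the topology induced by this map into the
product space (pointwise convergence on tensors). -/
noncomputable def tensorPairing (μ : Measure T) (f : T → WeakDual ℝ E) :
    {φ : T → ℝ // Measurable φ ∧ ∃ c : ℝ, ∀ t, |φ t| ≤ c} × E → ℝ :=
  fun p => ∫ t, p.1.1 t * f t p.2 ∂μ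

section Helpers

open Filter Topology TopologicalSpace

/-- Norm-closed bounded convex subsets of a real Hilbert space are weakly compact. -/
theorem aux_weakCompact {H : Type*} [NormedAddCommGroup H] [InnerProductSpace ℝ H]
    [CompleteSpace H] (C : Set H) (hC : Convex ℝ C) (hcl : IsClosed C) (M : ℝ)
    (hM : ∀ x ∈ C, ‖x‖ ≤ M) :
    IsCompact {l : WeakDual ℝ H | ∃ x ∈ C, ∀ z, l z = inner ℝ x z} := by
  have hrep : ∀ l : WeakDual ℝ H, ∃ x : H, ∀ z, l z = inner ℝ x z := by
    intro l
    refine ⟨(InnerProductSpace.toDual ℝ H).symm (WeakDual.toStrongDual l), fun z => ?_⟩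
    rw [InnerProductSpace.toDual_symm_apply]
    rfl
  refine IsCompact.of_isClosed_subset
    (WeakDual.isCompact_closedBall (𝕜 := ℝ) (E := H) 0 M) ?_ ?_
  · rw [← isOpen_compl_iff, isOpen_iff_mem_nhds]
    intro l hl
    obtain ⟨x, hx⟩ := hrep l
    have hxC : x ∉ C := fun h => hl ⟨x, h, hx⟩
    obtain ⟨g, u, hg, hu⟩ := geometric_hahn_banach_closed_point hC hcl hxC
    set y := (InnerProductSpace.toDual ℝ H).symm g with hy
    have hgy : ∀ z, g z = inner ℝ z y := by
      intro z
      rw [real_inner_comm, hy, InnerProductSpace.toDual_symm_apply]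
    have hopen : IsOpen {m : WeakDual ℝ H | u < m y} :=
      isOpen_lt continuous_const (WeakDual.eval_continuous y)
    refine Filter.mem_of_superset (hopen.mem_nhds (show u < l y by rw [hx, ← hgy]; exact hu)) ?_
    rintro m hm ⟨c, hc, hmc⟩
    have h1 : u < m y := hm
    have h2 := hg c hc
    rw [hgy, ← hmc] at h2
    exact lt_asymm h1 h2
  · rintro l ⟨x, hx, hl⟩
    have : WeakDual.toStrongDual l = InnerProductSpace.toDual ℝ H x := by
      ext z
      rw [InnerProductSpace.toDual_apply_apply]
      exact hl z
    simp only [Set.mem_preimage, Metric.mem_closedBall, dist_zero_right]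
    rw [this, LinearIsometryEquiv.norm_map]
    exact hM x hx

theorem aux_ext {E : Type*} [NormedAddCommGroup E] [NormedSpace ℝ E]
    {d : ℕ → E} (hd : DenseRange d) {p q : WeakDual ℝ E} (h : ∀ k, p (d k) = q (d k)) :
    p = q := by
  have : (p : E → ℝ) = q := hd.equalizer (map_continuous p) (map_continuous q) (funext h)
  exact DFunLike.coe_injective this

/-- Scalar measurability on a dense sequence implies weak* Borel measurability. -/
theorem aux_meas {T : Type*} [MeasurableSpace T] {E : Type*} [NormedAddCommGroup E]
    [NormedSpace ℝ E] [MeasurableSpace (WeakDual ℝ E)] [BorelSpace (WeakDual ℝ E)]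
    {d : ℕ → E} (hd : DenseRange d) (f : T → WeakDual ℝ E)
    (hf : ∀ k, Measurable fun t => f t (d k)) : Measurable f := by
  let e : WeakDual ℝ E → ℕ → ℝ := fun p k => p (d k)
  have hec : Continuous e := continuous_pi fun k => WeakDual.eval_continuous (d k)
  have hei : Function.Injective e := fun p q h => aux_ext hd fun k => congrFun h k
  have hef : Measurable (e ∘ f) := measurable_pi_lambda _ hf
  refine measurable_of_isClosed fun s hs => ?_
  have hB : ∀ n : ℕ, IsCompact (WeakDual.toStrongDual ⁻¹' Metric.closedBall (0 : StrongDual ℝ E) n) :=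
    fun n => WeakDual.isCompact_closedBall 0 n
  have : f ⁻¹' s = ⋃ n : ℕ, (e ∘ f) ⁻¹'
      (e '' (s ∩ (WeakDual.toStrongDual ⁻¹' Metric.closedBall (0 : StrongDual ℝ E) n))) := by
    ext t
    simp only [Set.mem_preimage, Set.mem_iUnion, Function.comp, hei.mem_set_image]
    constructor
    · intro h
      obtain ⟨n, hn⟩ := exists_nat_ge ‖WeakDual.toStrongDual (f t)‖
      exact ⟨n, h, by simpa using hn⟩
    · rintro ⟨n, h, -⟩
      exact h
  rw [this]
  exact MeasurableSet.iUnion fun n =>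
    hef (((hB n).inter_left hs).image hec).isClosed.measurableSet

theorem aux_convex {T : Type*} [MeasurableSpace T] {E : Type*} [NormedAddCommGroup E]
    [NormedSpace ℝ E] [MeasurableSpace (WeakDual ℝ E)] [BorelSpace (WeakDual ℝ E)]
    {d : ℕ → E} (hd : DenseRange d) (μ : Measure T) (Γ : T → Set (WeakDual ℝ E))
    (hconv : ∀ t, Convex ℝ (Γ t)) : Convex ℝ (gelfandSelectors μ Γ) := by
  rintro f ⟨hf1, hf2, hf3⟩ g ⟨hg1, hg2, hg3⟩ a b ha hb hab
  refine ⟨aux_meas hd _ fun k => ?_, fun y => ?_, ?_⟩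
  · exact (((WeakDual.eval_continuous (d k)).measurable.comp hf1).const_mul a).add
      (((WeakDual.eval_continuous (d k)).measurable.comp hg1).const_mul b)
  · exact ((hf2 y).const_mul a).add ((hg2 y).const_mul b)
  · filter_upwards [hf3, hg3] with t h1 h2
    exact hconv t h1 h2 ha hb hab

theorem aux_compact {E : Type*} [NormedAddCommGroup E]
    [NormedSpace ℝ E] (S : Set (WeakDual ℝ E)) (hS : IsClosed S) (c : ℝ)
    (hbd : ∀ p ∈ S, ∀ y : E, |p y| ≤ c * ‖y‖) : IsCompact S := by
  refine IsCompact.of_isClosed_subset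
    (WeakDual.isCompact_closedBall (𝕜 := ℝ) (E := E) 0 |c|) hS ?_
  intro p hp
  simp only [Set.mem_preimage, Metric.mem_closedBall, dist_zero_right]
  refine ContinuousLinearMap.opNorm_le_bound _ (abs_nonneg c) fun y => ?_
  exact (hbd p hp y).trans (mul_le_mul_of_nonneg_right (le_abs_self c) (norm_nonneg y))

theorem aux_integrable {T : Type*} [MeasurableSpace T] {E : Type*} [NormedAddCommGroup E]
    [NormedSpace ℝ E] [MeasurableSpace (WeakDual ℝ E)] [BorelSpace (WeakDual ℝ E)]
    (μ : Measure T) (Γ : T → Set (WeakDual ℝ E)) (φ : T → ℝ) (hφ : Integrable φ μ)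
    (hbd : ∀ t, ∀ p ∈ Γ t, ∀ y : E, |p y| ≤ φ t * ‖y‖) (f : T → WeakDual ℝ E)
    (hf : Measurable f) (hfΓ : ∀ᵐ t ∂μ, f t ∈ Γ t) (y : E) :
    Integrable (fun t => f t y) μ := by
  refine (hφ.mul_const ‖y‖).mono'
    ((WeakDual.eval_continuous y).measurable.comp hf).aestronglyMeasurable ?_
  filter_upwards [hfΓ] with t ht
  exact hbd t _ ht y

theorem aux_limit {T : Type*} [MeasurableSpace T] {E : Type*} [NormedAddCommGroup E]
    [NormedSpace ℝ E] [MeasurableSpace (WeakDual ℝ E)] [BorelSpace (WeakDual ℝ E)]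
    {d : ℕ → E} (hd : DenseRange d)
    (μ : Measure T) (Γ : T → Set (WeakDual ℝ E)) (hclosed : ∀ t, IsClosed (Γ t))
    (φ : T → ℝ) (hφ : Integrable φ μ)
    (hbd : ∀ t, ∀ p ∈ Γ t, ∀ y : E, |p y| ≤ φ t * ‖y‖) (F : ℕ → T → WeakDual ℝ E)
    (hF : ∀ n, F n ∈ gelfandSelectors μ Γ)
    (hlim : ∀ k, ∀ᵐ t ∂μ, ∃ l, Tendsto (fun n => F n t (d k)) atTop (𝓝 l)) :
    ∃ f ∈ gelfandSelectors μ Γ,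
      ∀ᵐ t ∂μ, ∀ k, Tendsto (fun n => F n t (d k)) atTop (𝓝 (f t (d k))) := by
  have hae : ∀ᵐ t ∂μ, ∃ p ∈ Γ t, ∀ k, Tendsto (fun n => F n t (d k)) atTop (𝓝 (p (d k))) := by
    filter_upwards [ae_all_iff.2 hlim, ae_all_iff.2 fun n => (hF n).2.2] with t h1 h2
    choose l hl using h1
    have hec : Continuous (fun (p : WeakDual ℝ E) (k : ℕ) => p (d k)) :=
      continuous_pi fun k => WeakDual.eval_continuous (d k)
    have hcl := ((aux_compact (Γ t) (hclosed t) _ (hbd t)).image hec).isClosed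
    have hmem : l ∈ (fun (p : WeakDual ℝ E) (k : ℕ) => p (d k)) '' Γ t :=
      hcl.mem_of_tendsto (tendsto_pi_nhds.2 hl)
        (Eventually.of_forall fun n => ⟨F n t, h2 n, rfl⟩)
    obtain ⟨p, hp, hpl⟩ := hmem
    refine ⟨p, hp, fun k => ?_⟩
    have := congrFun hpl k
    simp only at this
    rw [this]
    exact hl k
  obtain ⟨A, hAsub, hAm, hA0⟩ := exists_measurable_superset_of_null (ae_iff.1 hae)
  have hgood : ∀ t, t ∉ A → ∃ p ∈ Γ t, ∀ k, Tendsto (fun n => F n t (d k)) atTop (𝓝 (p (d k))) := by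
    intro t ht
    by_contra h
    exact ht (hAsub h)
  classical
  choose! g hg1 hg2 using hgood
  let f : T → WeakDual ℝ E := fun t => if t ∈ A then 0 else g t
  have hfA : ∀ t, t ∉ A → f t = g t := fun t ht => if_neg ht
  have hAae : ∀ᵐ t ∂μ, t ∉ A := by
    rw [ae_iff]; simpa using hA0
  have hfm : Measurable f := by
    refine aux_meas hd f fun k => ?_
    refine measurable_of_tendsto_metrizable (f := fun n t => if t ∈ A then (0 : ℝ) else F n t (d k))
      (fun n => Measurable.ite hAm measurable_const
        ((WeakDual.eval_continuous (d k)).measurable.comp (hF n).1)) ?_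
    refine tendsto_pi_nhds.2 fun t => ?_
    by_cases ht : t ∈ A
    · simp [f, ht]; rfl
    · simpa [f, ht] using hg2 t ht k
  have hfΓ : ∀ᵐ t ∂μ, f t ∈ Γ t := by
    filter_upwards [hAae] with t ht
    rw [hfA t ht]
    exact hg1 t ht
  refine ⟨f, ⟨hfm, aux_integrable μ Γ φ hφ hbd f hfm hfΓ, hfΓ⟩, ?_⟩
  filter_upwards [hAae] with t ht
  rw [hfA t ht]
  exact hg2 t ht

/-- The relation that `x` represents `f` in the Hilbert sum of copies of `L²(μ)`. -/
def auxRel {T : Type*} [MeasurableSpace T] {E : Type*} [NormedAddCommGroup E]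
    [NormedSpace ℝ E] (μ : Measure T) (d : ℕ → E) (s : ℕ → ℝ) (r : T → ℝ)
    (f : T → WeakDual ℝ E) (x : lp (fun _ : ℕ => Lp ℝ 2 μ) 2) : Prop :=
  ∀ k, (x k : T → ℝ) =ᵐ[μ] fun t => s k * (f t (d k) / r t)

theorem aux_closed {T : Type*} [MeasurableSpace T] {E : Type*} [NormedAddCommGroup E]
    [NormedSpace ℝ E] [MeasurableSpace (WeakDual ℝ E)] [BorelSpace (WeakDual ℝ E)]
    {d : ℕ → E} (hd : DenseRange d)
    (μ : Measure T) [IsFiniteMeasure μ] (Γ : T → Set (WeakDual ℝ E))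
    (hclosed : ∀ t, IsClosed (Γ t))
    (φ : T → ℝ) (hφ : Integrable φ μ)
    (hbd : ∀ t, ∀ p ∈ Γ t, ∀ y : E, |p y| ≤ φ t * ‖y‖)
    (s : ℕ → ℝ) (hs : ∀ k, 0 < s k) (r : T → ℝ) (hr : ∀ t, 0 < r t) :
    IsClosed {x | ∃ f ∈ gelfandSelectors μ Γ, auxRel μ d s r f x} := by
  rw [← isSeqClosed_iff_isClosed]
  intro X x hX hXx
  -- fast subsequence
  obtain ⟨ns, hns, hfast⟩ : ∃ ns : ℕ → ℕ, StrictMono ns ∧ ∀ n, ‖X (ns n) - x‖ < (1 / 2) ^ n := by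
    refine extraction_forall_of_eventually' (P := fun n m => ‖X m - x‖ < (1 / 2) ^ n) fun n => ?_
    have := (Metric.tendsto_atTop.1 hXx) ((1 / 2) ^ n) (by positivity)
    obtain ⟨N, hN⟩ := this
    exact ⟨N, fun m hm => by simpa [dist_eq_norm] using hN m hm⟩
  choose F hF hrel using fun n => hX (ns n)
  have hcoord : ∀ k (a : lp (fun _ : ℕ => Lp ℝ 2 μ) 2), ‖a k‖ ≤ ‖a‖ := fun k a =>
    lp.norm_apply_le_norm (by norm_num) a k
  have hconvk : ∀ k, Tendsto (fun n => X (ns n) k) atTop (𝓝 (x k)) := by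
    intro k
    rw [tendsto_iff_norm_sub_tendsto_zero]
    refine squeeze_zero (fun _ => norm_nonneg _) (fun n => ?_)
      (tendsto_pow_atTop_nhds_zero_of_lt_one (r := (1 / 2 : ℝ)) (by norm_num) (by norm_num))
    exact (hcoord k (X (ns n) - x)).trans (hfast n).le
  have hlimX : ∀ k, ∀ᵐ t ∂μ, ∃ l, Tendsto (fun n => X (ns n) k t) atTop (𝓝 l) := by
    intro k
    refine Lp.ae_tendsto_of_cauchy_eLpNorm (p := 2) (B := fun N => ENNReal.ofReal (2 * (1 / 2) ^ N))
      (fun n => Lp.aestronglyMeasurable _) (by norm_num) ?_ ?_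
    · rw [← ENNReal.ofReal_tsum_of_nonneg (fun n => by positivity)
        ((summable_geometric_two).mul_left 2)]
      exact ENNReal.ofReal_ne_top
    · intro N n m hn hm
      rw [← eLpNorm_congr_ae (Lp.coeFn_sub (X (ns n) k) (X (ns m) k))]
      rw [← ENNReal.ofReal_toReal (Lp.eLpNorm_ne_top _), ← Lp.norm_def]
      refine (ENNReal.ofReal_lt_ofReal_iff (by positivity)).2 ?_
      have e : X (ns n) k - X (ns m) k = (X (ns n) - x) k - (X (ns m) - x) k := by
        simp
      rw [e]
      have h1 : ∀ j, N ≤ j → ‖(X (ns j) - x) k‖ < (1 / 2) ^ N := fun j hj =>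
        ((hcoord k _).trans_lt (hfast j)).trans_le
          (pow_le_pow_of_le_one (by norm_num) (by norm_num) hj)
      linarith [norm_sub_le ((X (ns n) - x) k) ((X (ns m) - x) k), h1 n hn, h1 m hm]
  have hlim : ∀ k, ∀ᵐ t ∂μ, ∃ l, Tendsto (fun n => F n t (d k)) atTop (𝓝 l) := by
    intro k
    filter_upwards [hlimX k, ae_all_iff.2 fun n => hrel n k] with t ⟨l, hl⟩ h2
    refine ⟨r t / s k * l, (hl.const_mul (r t / s k)).congr fun n => ?_⟩
    rw [h2 n]
    have := (hs k).ne'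
    have := (hr t).ne'
    field_simp
  obtain ⟨f, hf, hft⟩ := aux_limit hd μ Γ hclosed φ hφ hbd F hF hlim
  refine ⟨f, hf, fun k => ?_⟩
  refine tendstoInMeasure_ae_unique (tendstoInMeasure_of_tendsto_Lp (hconvk k))
    (tendstoInMeasure_of_tendsto_ae (fun n => Lp.aestronglyMeasurable _) ?_)
  filter_upwards [hft, ae_all_iff.2 fun n => hrel n k] with t h1 h2
  simp only [h2]
  exact ((h1 k).div_const _).const_mul _

theorem aux_relconvex {T : Type*} [MeasurableSpace T] {E : Type*} [NormedAddCommGroup E]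
    [NormedSpace ℝ E] (μ : Measure T) (d : ℕ → E) (s : ℕ → ℝ) (r : T → ℝ)
    (S : Set (T → WeakDual ℝ E)) (hS : Convex ℝ S) :
    Convex ℝ {x | ∃ f ∈ S, auxRel μ d s r f x} := by
  rintro x ⟨f, hf, hfx⟩ y ⟨g, hg, hgy⟩ a b ha hb hab
  refine ⟨a • f + b • g, hS hf hg ha hb hab, fun k => ?_⟩
  have e : (a • x + b • y) k = a • x k + b • y k := rfl
  rw [e]
  filter_upwards [hfx k, hgy k, Lp.coeFn_add (a • x k) (b • y k), Lp.coeFn_smul a (x k),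
    Lp.coeFn_smul b (y k)] with t h1 h2 h3 h4 h5
  rw [h3, Pi.add_apply, h4, h5, Pi.smul_apply, Pi.smul_apply, h1, h2]
  have : (a • f + b • g) t (d k) = a * f t (d k) + b * g t (d k) := rfl
  rw [this]
  simp only [smul_eq_mul]
  ring

theorem aux_exists {T : Type*} [MeasurableSpace T] {E : Type*} [NormedAddCommGroup E]
    [NormedSpace ℝ E] [MeasurableSpace (WeakDual ℝ E)] [BorelSpace (WeakDual ℝ E)]
    (d : ℕ → E) (μ : Measure T) (Γ : T → Set (WeakDual ℝ E)) (φ : T → ℝ)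
    (hbd : ∀ t, ∀ p ∈ Γ t, ∀ y : E, |p y| ≤ φ t * ‖y‖)
    (s : ℕ → ℝ) (hs : ∀ k, 0 < s k) (hsd : ∀ k, s k * ‖d k‖ ≤ (1 / 2) ^ k)
    (r : T → ℝ) (hr : ∀ t, 0 < r t) (hrm : Measurable r) (hr2 : MemLp r 2 μ)
    (hφr : ∀ᵐ t ∂μ, φ t ≤ r t ^ 2) :
    ∃ M : ℝ, ∀ f ∈ gelfandSelectors μ Γ, (∃ x, auxRel μ d s r f x) ∧
      ∀ x, auxRel μ d s r f x → ‖x‖ ≤ M := by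
  let R : Lp ℝ 2 μ := hr2.toLp r
  have hsum : Summable fun k : ℕ => ((1 / 2 : ℝ) ^ k * ‖R‖) ^ (ENNReal.toReal 2) := by
    have : (fun k : ℕ => ((1 / 2 : ℝ) ^ k * ‖R‖) ^ (ENNReal.toReal 2)) =
        fun k : ℕ => (1 / 4 : ℝ) ^ k * ‖R‖ ^ 2 := by
      funext k
      rw [ENNReal.toReal_ofNat, Real.rpow_ofNat, mul_pow, ← pow_mul, mul_comm k, pow_mul]
      norm_num
    rw [this]
    exact (summable_geometric_of_lt_one (by norm_num) (by norm_num)).mul_right _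
  let Y : lp (fun _ : ℕ => Lp ℝ 2 μ) 2 := ⟨fun k => (1 / 2 : ℝ) ^ k • R, by
    refine memℓp_gen ?_
    simpa [norm_smul] using hsum⟩
  have hpt : ∀ f ∈ gelfandSelectors μ Γ, ∀ k, ∀ᵐ t ∂μ,
      ‖s k * (f t (d k) / r t)‖ ≤ (1 / 2) ^ k * ‖r t‖ := by
    intro f hf k
    filter_upwards [hf.2.2, hφr] with t h1 h2
    have h3 := hbd t _ h1 (d k)
    have h4 : |f t (d k)| ≤ r t ^ 2 * ‖d k‖ :=
      h3.trans (mul_le_mul_of_nonneg_right h2 (norm_nonneg _))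
    rw [Real.norm_eq_abs, Real.norm_eq_abs, abs_mul, abs_div, abs_of_pos (hs k), abs_of_pos (hr t)]
    calc s k * (|f t (d k)| / r t) ≤ s k * ((r t ^ 2 * ‖d k‖) / r t) := by
          have := hr t
          have := hs k
          gcongr
      _ = (s k * ‖d k‖) * r t := by
          have := (hr t).ne'
          field_simp
      _ ≤ _ := mul_le_mul_of_nonneg_right (hsd k) (hr t).le
  have hnorm : ∀ f ∈ gelfandSelectors μ Γ, ∀ k (z : Lp ℝ 2 μ),
      (z : T → ℝ) =ᵐ[μ] (fun t => s k * (f t (d k) / r t)) → ‖z‖ ≤ (1 / 2) ^ k * ‖R‖ := by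
    intro f hf k z hz
    refine Lp.norm_le_mul_norm_of_ae_le_mul ?_
    filter_upwards [hz, hpt f hf k, hr2.coeFn_toLp] with t h1 h2 h3
    rw [h1, h3]
    exact h2
  refine ⟨‖Y‖, fun f hf => ⟨?_, ?_⟩⟩
  · have hmem : ∀ k, MemLp (fun t => s k * (f t (d k) / r t)) 2 μ := by
      intro k
      refine (hr2.const_mul ((1 / 2 : ℝ) ^ k)).mono ?_ ?_
      · exact ((((WeakDual.eval_continuous (d k)).measurable.comp hf.1).div
          hrm).const_mul (s k)).aestronglyMeasurable
      · filter_upwards [hpt f hf k] with t ht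
        refine ht.trans (le_of_eq ?_)
        rw [norm_mul]
        simp
    refine ⟨⟨fun k => (hmem k).toLp _, ?_⟩, fun k => (hmem k).coeFn_toLp⟩
    refine memℓp_gen (hsum.of_nonneg_of_le (fun k => by positivity) fun k => ?_)
    exact Real.rpow_le_rpow (norm_nonneg _) (hnorm f hf k _ (hmem k).coeFn_toLp) (by simp)
  · intro x hx
    refine lp.norm_mono (by norm_num) fun k => ?_
    refine (hnorm f hf k _ (hx k)).trans (le_of_eq ?_)
    change _ = ‖(1 / 2 : ℝ) ^ k • R‖
    rw [norm_smul]
    simp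

theorem aux_pair {T : Type*} [MeasurableSpace T] {E : Type*} [NormedAddCommGroup E]
    [NormedSpace ℝ E] (d : ℕ → E) (μ : Measure T)
    (s : ℕ → ℝ) (hs : ∀ k, 0 < s k) (r : T → ℝ) (hr : ∀ t, 0 < r t) (hr2 : MemLp r 2 μ)
    (ψ : T → ℝ) (hψ : Measurable ψ) (c : ℝ) (hc : ∀ t, |ψ t| ≤ c) (k : ℕ) :
    ∃ z : lp (fun _ : ℕ => Lp ℝ 2 μ) 2, ∀ f x, auxRel μ d s r f x →
      ∫ t, ψ t * f t (d k) ∂μ = inner ℝ x z := by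
  have hmem : MemLp (fun t => ψ t * r t / s k) 2 μ := by
    refine (hr2.const_mul (c / s k)).mono
      ((hψ.aemeasurable.mul hr2.1.aemeasurable).div_const _).aestronglyMeasurable (Eventually.of_forall fun t => ?_)
    have hc0 : 0 ≤ c := (abs_nonneg _).trans (hc t)
    rw [Real.norm_eq_abs, Real.norm_eq_abs, abs_div, abs_mul, abs_mul, abs_div,
      abs_of_nonneg hc0, abs_of_pos (hs k), div_mul_eq_mul_div]
    have := hs k
    have := hc t
    gcongr
  refine ⟨lp.single 2 k (hmem.toLp _), fun f x hx => ?_⟩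
  rw [lp.inner_single_right, L2.inner_def]
  refine integral_congr_ae ?_
  filter_upwards [hx k, hmem.coeFn_toLp] with t h1 h2
  rw [h1, h2]
  have := (hs k).ne'
  have := (hr t).ne'
  simp only [RCLike.inner_apply, conj_trivial]
  field_simp

end Helpers

/-- `(T,Σ,μ)` complete finite measure space, `E` separable Banach,
`Γ : T ⇉ E*` integrably bounded with weakly* closed convex values and measurable graph.
Then `S¹_Γ` is convex and compact for the topology `σ(G¹_{E*}, L^∞ ⊗ E)`: convexity holds
as a subset of the function space, and compactness is expressed as compactness of the image
of `S¹_Γ` under the tensor pairing (which induces the `σ(G¹_{E*}, L^∞ ⊗ E)`-topology,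
identifying weakly* scalarly equivalent functions). -/
theorem stmt12 (μ : Measure T) [IsFiniteMeasure μ] (hcomplete : μ.IsComplete)
    [CompleteSpace E] [TopologicalSpace.SeparableSpace E] [BorelSpace (WeakDual ℝ E)]
    (Γ : T → Set (WeakDual ℝ E)) (hne : ∀ t, (Γ t).Nonempty)
    (hclosed : ∀ t, IsClosed (Γ t)) (hconv : ∀ t, Convex ℝ (Γ t))
    (φ : T → ℝ) (hφ : Integrable φ μ)
    (hbd : ∀ t, ∀ p ∈ Γ t, ∀ y : E, |p y| ≤ φ t * ‖y‖)
    (hgraph : MeasurableSet {q : T × WeakDual ℝ E | q.2 ∈ Γ q.1}) :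
    Convex ℝ (gelfandSelectors μ Γ) ∧
      IsCompact (tensorPairing μ '' gelfandSelectors μ Γ) := by
  classical
  set d : ℕ → E := TopologicalSpace.denseSeq E with hddef
  have hd : DenseRange d := TopologicalSpace.denseRange_denseSeq E
  have hS := aux_convex hd μ Γ hconv
  refine ⟨hS, ?_⟩
  -- the weights
  let s : ℕ → ℝ := fun k => (1 / 2) ^ k / (1 + ‖d k‖)
  have hs : ∀ k, 0 < s k := fun k => by positivity
  have hsd : ∀ k, s k * ‖d k‖ ≤ (1 / 2) ^ k := by
    intro k
    have h0 := norm_nonneg (d k)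
    change (1 / 2) ^ k / (1 + ‖d k‖) * ‖d k‖ ≤ (1 / 2) ^ k
    rw [div_mul_eq_mul_div, div_le_iff₀ (by positivity)]
    exact mul_le_mul_of_nonneg_left (by linarith) (by positivity)
  let φ' : T → ℝ := hφ.1.mk φ
  have hφ'm : Measurable φ' := hφ.1.stronglyMeasurable_mk.measurable
  have hφ'e : φ =ᵐ[μ] φ' := hφ.1.ae_eq_mk
  have hφ'i : Integrable φ' μ := hφ.congr hφ'e
  let r : T → ℝ := fun t => Real.sqrt (1 + |φ' t|)
  have hr : ∀ t, 0 < r t := fun t => Real.sqrt_pos.2 (by positivity)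
  have hrsq : ∀ t, r t ^ 2 = 1 + |φ' t| := fun t => Real.sq_sqrt (by positivity)
  have hrm : Measurable r := ((hφ'm.abs).const_add 1).sqrt
  have hr2 : MemLp r 2 μ := by
    rw [memLp_two_iff_integrable_sq hrm.aestronglyMeasurable]
    simp only [hrsq]
    exact (integrable_const 1).add hφ'i.abs
  have hφr : ∀ᵐ t ∂μ, φ t ≤ r t ^ 2 := by
    filter_upwards [hφ'e] with t ht
    rw [hrsq, ht]
    linarith [le_abs_self (φ' t)]
  obtain ⟨M, hM⟩ := aux_exists d μ Γ φ hbd s hs hsd r hr hrm hr2 hφr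
  let C := {x | ∃ f ∈ gelfandSelectors μ Γ, auxRel μ d s r f x}
  have hCcl : IsClosed C := aux_closed hd μ Γ hclosed φ hφ hbd s hs r hr
  have hCcv : Convex ℝ C := aux_relconvex μ d s r _ hS
  have hcomp := aux_weakCompact C hCcv hCcl M (fun x ⟨f, hf, hfx⟩ => (hM f hf).2 x hfx)
  set K := {l : WeakDual ℝ (lp (fun _ : ℕ => Lp ℝ 2 μ) 2) | ∃ x ∈ C, ∀ z, l z = inner ℝ x z}
    with hK
  have hch : ∀ l ∈ K, ∃ f ∈ gelfandSelectors μ Γ, ∃ x, auxRel μ d s r f x ∧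
      ∀ z, l z = inner ℝ x z := by
    rintro l ⟨x, ⟨f, hf, hfx⟩, hl⟩
    exact ⟨f, hf, x, hfx, hl⟩
  choose! Φ hΦ X hX hXl using hch
  have hint : ∀ f ∈ gelfandSelectors μ Γ,
      ∀ (q : {φ : T → ℝ // Measurable φ ∧ ∃ c : ℝ, ∀ t, |φ t| ≤ c}) (y : E),
      Integrable (fun t => q.1 t * f t y) μ := by
    intro f hf q y
    obtain ⟨c, hc⟩ := q.2.2
    exact (hf.2.1 y).bdd_mul q.2.1.aestronglyMeasurable (Filter.Eventually.of_forall hc)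
  have himage : tensorPairing μ '' gelfandSelectors μ Γ = (fun l => tensorPairing μ (Φ l)) '' K := by
    ext L
    constructor
    · rintro ⟨f, hf, rfl⟩
      obtain ⟨x, hx⟩ := (hM f hf).1
      let l : WeakDual ℝ (lp (fun _ : ℕ => Lp ℝ 2 μ) 2) :=
        StrongDual.toWeakDual (InnerProductSpace.toDual ℝ _ x)
      have hlz : ∀ z, l z = inner ℝ x z := fun z => InnerProductSpace.toDual_apply_apply ..
      have hl : l ∈ K := ⟨x, ⟨f, hf, hx⟩, hlz⟩
      refine ⟨l, hl, ?_⟩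
      have hxx : X l = x := by
        refine ext_inner_right ℝ fun z => ?_
        rw [← hXl l hl, hlz]
      have hae : ∀ᵐ t ∂μ, Φ l t = f t := by
        have h1 := hX l hl
        rw [hxx] at h1
        filter_upwards [MeasureTheory.ae_all_iff.2 h1, MeasureTheory.ae_all_iff.2 hx] with t h2 h3
        refine aux_ext hd fun k => ?_
        have h4 := (h2 k).symm.trans (h3 k)
        have h5 := mul_left_cancel₀ (hs k).ne' h4
        exact (div_left_inj' (hr t).ne').1 h5
      funext p
      refine integral_congr_ae ?_
      filter_upwards [hae] with t ht
      rw [ht]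
    · rintro ⟨l, hl, rfl⟩
      exact ⟨Φ l, hΦ l hl, rfl⟩
  rw [himage]
  refine hcomp.image_of_continuousOn (continuousOn_pi.2 ?_)
  rintro ⟨ψ, y⟩
  obtain ⟨c, hc⟩ := ψ.2.2
  refine continuousOn_of_uniform_approx_of_continuousOn fun u hu => ?_
  obtain ⟨ε, hε, hεu⟩ := Metric.mem_uniformity_dist.1 hu
  set I : ℝ := |c| * ∫ t, |φ t| ∂μ with hI
  have hI0 : 0 ≤ I := mul_nonneg (abs_nonneg _) (integral_nonneg fun t => abs_nonneg _)
  obtain ⟨k, hk⟩ := hd.exists_dist_lt y (ε := ε / (I + 1)) (by positivity)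
  obtain ⟨z, hz⟩ := aux_pair d μ s hs r hr hr2 ψ.1 ψ.2.1 c hc k
  refine ⟨fun l => l z, (WeakDual.eval_continuous z).continuousOn, fun l hl => hεu ?_⟩
  beta_reduce
  rw [hXl l hl, ← hz _ _ (hX l hl)]
  simp only [tensorPairing]
  rw [Real.dist_eq, ← integral_sub (hint _ (hΦ l hl) ψ y) (hint _ (hΦ l hl) ψ (d k))]
  rw [dist_eq_norm] at hk
  have hb : ∀ᵐ t ∂μ, ‖ψ.1 t * Φ l t y - ψ.1 t * Φ l t (d k)‖ ≤ |c| * ‖y - d k‖ * |φ t| := by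
    filter_upwards [(hΦ l hl).2.2] with t ht
    have h1 := hbd t _ ht (y - d k)
    rw [map_sub] at h1
    rw [← mul_sub, norm_mul, Real.norm_eq_abs, Real.norm_eq_abs]
    have h2 : |Φ l t y - Φ l t (d k)| ≤ |φ t| * ‖y - d k‖ :=
      h1.trans (mul_le_mul_of_nonneg_right (le_abs_self _) (norm_nonneg _))
    calc _ ≤ |c| * (|φ t| * ‖y - d k‖) :=
          mul_le_mul ((hc t).trans (le_abs_self c)) h2 (abs_nonneg _) (abs_nonneg _)
      _ = _ := by ring
  have h3 := norm_integral_le_of_norm_le (hφ.abs.const_mul (|c| * ‖y - d k‖)) hb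
  rw [Real.norm_eq_abs, integral_const_mul] at h3
  have h4 : |c| * ‖y - d k‖ * ∫ t, |φ t| ∂μ = ‖y - d k‖ * I := by rw [hI]; ring
  rw [h4] at h3
  refine h3.trans_lt ?_
  rw [lt_div_iff₀ (by positivity)] at hk
  nlinarith [norm_nonneg (y - d k)]
end
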